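/- arXiv:2212.06937 — 3 statements merged into one kernel-verified Lean document; each statement's English description precedes it below -/
import Mathlib

section
/- Functors that are injective on objects lift against surjective equivalences: given categories A, B, C, D, a functor I : A ⟶ B that is injective on objects, a functor P : C ⟶ D that is full, faithful, and surjective on objects, and functors K : A ⟶ C and L : B ⟶ D with I ⋙ L = K ⋙ P (strict equality of functors), there exists a functor M : B ⟶ C with I ⋙ M = K and M ⋙ P = L (strict equalities of functors). -/
open CategoryTheory

universe v₁ v₂ v₃ v₄ u₁ u₂ u₃ u₄

/-- A functor into `D` lifts strictly through a fully faithful functor once its objects do. -/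
noncomputable def CategoryTheory.Functor.strictLift
    {B : Type u₁} [Category.{v₁} B] {C : Type u₂} [Category.{v₂} C]
    {D : Type u₃} [Category.{v₃} D] (P : C ⥤ D) [P.Full] [P.Faithful] (L : B ⥤ D)
    (m : B → C) (hm : ∀ b, P.obj (m b) = L.obj b) : B ⥤ C where
  obj := m
  map {b b'} f := P.preimage (eqToHom (hm b) ≫ L.map f ≫ eqToHom (hm b').symm)
  map_id b := P.map_injective (by simp)
  map_comp f g := P.map_injective (by simp)

theorem CategoryTheory.Functor.strictLift_comp
    {B : Type u₁} [Category.{v₁} B] {C : Type u₂} [Category.{v₂} C]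
    {D : Type u₃} [Category.{v₃} D] (P : C ⥤ D) [P.Full] [P.Faithful] (L : B ⥤ D)
    (m : B → C) (hm : ∀ b, P.obj (m b) = L.obj b) : P.strictLift L m hm ⋙ P = L :=
  Functor.ext hm fun _ _ f => by simp [Functor.strictLift]

/-- Functors that agree on objects are equal if they become equal after composing with a
faithful functor. -/
theorem CategoryTheory.Functor.eq_of_comp_faithful_eq
    {A : Type u₁} [Category.{v₁} A] {C : Type u₂} [Category.{v₂} C]
    {D : Type u₃} [Category.{v₃} D] {F G : A ⥤ C} (P : C ⥤ D) [P.Faithful]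
    (hobj : ∀ a, F.obj a = G.obj a) (h : F ⋙ P = G ⋙ P) : F = G :=
  Functor.ext hobj fun _ _ f => P.map_injective (by
    simpa [eqToHom_map] using Functor.congr_hom h f)

/-- Functors that are injective on objects lift (strictly) against functors that are full,
faithful, and surjective on objects: given `I : A ⥤ B` injective on objects, `P : C ⥤ D`
a surjective equivalence, and `K`, `L` with `I ⋙ L = K ⋙ P`, there is `M : B ⥤ C` with
`I ⋙ M = K` and `M ⋙ P = L`. -/
theorem injective_on_objects_lift_against_surjective_equivalence
    {A : Type u₁} [Category.{v₁} A] {B : Type u₂} [Category.{v₂} B]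
    {C : Type u₃} [Category.{v₃} C] {D : Type u₄} [Category.{v₄} D]
    (I : A ⥤ B) (hI : Function.Injective I.obj)
    (P : C ⥤ D) [P.Full] [P.Faithful] (hP : Function.Surjective P.obj)
    (K : A ⥤ C) (L : B ⥤ D) (hsq : I ⋙ L = K ⋙ P) :
    ∃ M : B ⥤ C, I ⋙ M = K ∧ M ⋙ P = L := by
  have hsq_obj (a : A) : L.obj (I.obj a) = P.obj (K.obj a) := Functor.congr_obj hsq a
  choose s hs using fun b => hP (L.obj b)
  let m : B → C := Function.extend I.obj K.obj s
  have hmI (a : A) : m (I.obj a) = K.obj a := hI.extend_apply K.obj s a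
  have hm (b : B) : P.obj (m b) = L.obj b := by
    by_cases hb : ∃ a, I.obj a = b
    · obtain ⟨a, rfl⟩ := hb
      rw [hmI, hsq_obj]
    · rw [show m b = s b from Function.extend_apply' K.obj s b hb, hs]
  refine ⟨P.strictLift L m hm, ?_, P.strictLift_comp L m hm⟩
  refine Functor.eq_of_comp_faithful_eq P hmI ?_
  rw [Functor.assoc, P.strictLift_comp, hsq]
end

section
/- Fibrancy of a universe is equivalent to the fibration extension property: let 𝓔 be a model category in which every object is cofibrant, let S be a class of morphisms of 𝓔 such that every morphism in S is a fibration and pullbacks of morphisms in S along arbitrary morphisms exist and again lie in S, and let π : Ũ ⟶ U be a morphism in S. Assume (classification) every morphism in S is the left leg of some pullback square whose right leg is π, and (realignment) for every cofibration i : A ⟶ B, every p : E ⟶ B in S, every pullback square with left leg q : D ⟶ A, top map m : D ⟶ E, bottom map i and right leg p, and every pullback square (g : D ⟶ Ũ over h : A ⟶ U) exhibiting q as a pullback of π, there exist morphisms k : B ⟶ U and l : E ⟶ Ũ forming a pullback square exhibiting p as a pullback of π, with k ∘ i = h and l ∘ m = g. Then U is a fibrant object of 𝓔 if and only if 𝓔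 has the fibration extension property for S: for every q : D ⟶ A in S and every trivial cofibration j : A ⟶ B there exist p : E ⟶ B in S and a morphism D ⟶ E forming a pullback square with legs q, j, p. -/
open CategoryTheory Limits

universe v u

variable {𝓔 : Type u} [Category.{v} 𝓔]

/-- A pair of classes of morphisms forms a *weak factorization system* if every morphism
factors as a left map followed by a right map, and the two classes are characterized by
the left and right lifting properties against each other. -/
structure IsWeakFactorizationSystem (L R : MorphismProperty 𝓔) : Prop where
  factorization : ∀ {X Y : 𝓔} (f : X ⟶ Y),
    ∃ (Z : 𝓔) (l : X ⟶ Z) (r : Z ⟶ Y), L l ∧ R r ∧ l ≫ r = f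
  lift : ∀ {A B X Y : 𝓔} (i : A ⟶ B) (p : X ⟶ Y), L i → R p → HasLiftingProperty i p
  llp : ∀ {A B : 𝓔} (i : A ⟶ B),
    (∀ {X Y : 𝓔} (p : X ⟶ Y), R p → HasLiftingProperty i p) → L i
  rlp : ∀ {X Y : 𝓔} (p : X ⟶ Y),
    (∀ {A B : 𝓔} (i : A ⟶ B), L i → HasLiftingProperty i p) → R p

/-- A *model structure* on a complete and cocomplete category consists of three classes of
morphisms — cofibrations, weak equivalences and fibrations — such that
`(C, F ∩ W)` and `(C ∩ W, F)` are weak factorization systems and `W` satisfies 2-of-3. -/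
structure ModelStructure (𝓔 : Type u) [Category.{v} 𝓔] where
  C : MorphismProperty 𝓔
  W : MorphismProperty 𝓔
  F : MorphismProperty 𝓔
  wfs₁ : IsWeakFactorizationSystem C (fun {_ _} f => F f ∧ W f)
  wfs₂ : IsWeakFactorizationSystem (fun {_ _} f => C f ∧ W f) F
  two_of_three_comp : ∀ {X Y Z : 𝓔} (f : X ⟶ Y) (g : Y ⟶ Z), W f → W g → W (f ≫ g)
  two_of_three_left : ∀ {X Y Z : 𝓔} (f : X ⟶ Y) (g : Y ⟶ Z), W g → W (f ≫ g) → W f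
  two_of_three_right : ∀ {X Y Z : 𝓔} (f : X ⟶ Y) (g : Y ⟶ Z), W f → W (f ≫ g) → W g

/-- Fibrancy of a universe is equivalent to the fibration extension property.

Let `𝓔` be a model category in which every object is cofibrant, `S` a class of fibrations
that is stable under pullback, and `π : Utilde ⟶ U` a morphism of `S` satisfying classification
(every morphism of `S` is a pullback of `π`) and realignment. Then `U` is fibrant if and
only if `𝓔` has the fibration extension property for `S`. -/
theorem fibrant_universe_iff_fibration_extension
    [HasLimits 𝓔] [HasColimits 𝓔] (M : ModelStructure 𝓔)
    (allCofibrant : ∀ X : 𝓔, M.C (initial.to X))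
    (S : MorphismProperty 𝓔)
    (hSF : ∀ {X Y : 𝓔} (f : X ⟶ Y), S f → M.F f)
    (hSpb : ∀ {D A E B : 𝓔} (m : D ⟶ E) (q : D ⟶ A) (p : E ⟶ B) (i : A ⟶ B),
      IsPullback m q p i → S p → S q)
    {Utilde U : 𝓔} (π : Utilde ⟶ U) (hπ : S π)
    (classification : ∀ {E B : 𝓔} (p : E ⟶ B), S p →
      ∃ (k : B ⟶ U) (l : E ⟶ Utilde), IsPullback l p π k)
    (realignment : ∀ {A B D E : 𝓔} (i : A ⟶ B) (_ : M.C i)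
      (p : E ⟶ B) (_ : S p) (q : D ⟶ A) (m : D ⟶ E) (_ : IsPullback m q p i)
      (h : A ⟶ U) (g : D ⟶ Utilde) (_ : IsPullback g q π h),
      ∃ (k : B ⟶ U) (l : E ⟶ Utilde), IsPullback l p π k ∧ i ≫ k = h ∧ m ≫ l = g) :
    M.F (terminal.from U) ↔
      (∀ {D A : 𝓔} (q : D ⟶ A), S q → ∀ {B : 𝓔} (j : A ⟶ B), M.C j → M.W j →
        ∃ (E : 𝓔) (p : E ⟶ B) (m : D ⟶ E), S p ∧ IsPullback m q p j) := by
  constructor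
  · intro hU D A q hq B j hjC hjW
    obtain ⟨h, g, hg⟩ := classification q hq
    have : HasLiftingProperty j (terminal.from U) := M.wfs₂.lift j _ ⟨hjC, hjW⟩ hU
    have sq : CommSq h j (terminal.from U) (terminal.from B) := ⟨Subsingleton.elim _ _⟩
    have hE : IsPullback (pullback.fst π sq.lift) (pullback.snd π sq.lift) π sq.lift :=
      IsPullback.of_hasPullback _ _
    have w : g ≫ π = (q ≫ j) ≫ sq.lift := by
      rw [Category.assoc, sq.fac_left, hg.w]
    refine ⟨_, pullback.snd π sq.lift, hE.lift g (q ≫ j) w, hSpb _ _ _ _ hE hπ, ?_⟩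
    refine IsPullback.of_right ?_ (hE.lift_snd _ _ w) hE
    rw [hE.lift_fst, sq.fac_left]
    exact hg
  · intro hext
    refine M.wfs₂.rlp _ fun {A B} j hj => ⟨fun {h b} sq => ?_⟩
    have hD : IsPullback (pullback.fst π h) (pullback.snd π h) π h :=
      IsPullback.of_hasPullback _ _
    obtain ⟨E, p, m, hp, hm⟩ := hext _ (hSpb _ _ _ _ hD hπ) j hj.1 hj.2
    obtain ⟨k, l, -, hk, -⟩ := realignment j hj.1 p hp _ m hm h _ hD
    exact ⟨⟨⟨k, hk, Subsingleton.elim _ _⟩⟩⟩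
end

section
/- In a right proper model category, the equivalence extension property implies the fibration extension property. Precisely, let 𝓔 be a model category that is right proper (the pullback of a weak equivalence along a fibration is a weak equivalence) and suppose 𝓔 satisfies the equivalence extension property: for every cofibration i : A ⟶ B, fibrations p₁ : E₁ ⟶ A and p₂ : E₂ ⟶ A, weak equivalence w : E₁ ⟶ E₂ with p₂ ∘ w = p₁, fibration q₂ : D₂ ⟶ B, and pullback square with top map m₂ : E₂ ⟶ D₂ exhibiting p₂ as the pullback of q₂ along i, there exist a fibration q₁ : D₁ ⟶ B, a weak equivalence v : D₁ ⟶ D₂ with q₂ ∘ v = q₁, and a pullback square with top map m₁ : E₁ ⟶ D₁ exhibiting p₁ as the pullback of q₁ along i such that v ∘ m₁ = m₂ ∘ w. Then 𝓔 satisfies the fibration extension property: for every fibration q : D ⟶ A and every trivial cofibration j : A ⟶ B there exist a fibration p : E ⟶ B and a morphism D ⟶ E forming a pullback square with legs q, j, p. -/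
open CategoryTheory Limits

universe v u

variable {𝓔 : Type u} [Category.{v} 𝓔]

/-- The right class of a weak factorization system is stable under base change. -/
theorem IsWeakFactorizationSystem.right_of_isPullback {L R : MorphismProperty 𝓔}
    (h : IsWeakFactorizationSystem L R) {P X Y Z : 𝓔} {a : P ⟶ X} {b : P ⟶ Y} {p : X ⟶ Z}
    {f : Y ⟶ Z} (sq : IsPullback a b p f) (hp : R p) : R b :=
  h.rlp b fun i hi ↦
    haveI := h.lift i p hi hp
    sq.hasLiftingProperty i

/-- In a right proper model category, the equivalence extension property implies the
fibration extension property. -/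
theorem equivalence_extension_implies_fibration_extension
    [HasLimits 𝓔] [HasColimits 𝓔] (M : ModelStructure 𝓔)
    (rightProper : ∀ {P X Y Z : 𝓔} (a : P ⟶ X) (b : P ⟶ Y) (p : X ⟶ Z) (w : Y ⟶ Z),
      IsPullback a b p w → M.F p → M.W w → M.W a)
    (EEP : ∀ {A B E₁ E₂ D₂ : 𝓔} (i : A ⟶ B) (_ : M.C i)
      (p₁ : E₁ ⟶ A) (_ : M.F p₁) (p₂ : E₂ ⟶ A) (_ : M.F p₂)
      (w : E₁ ⟶ E₂) (_ : M.W w) (_ : w ≫ p₂ = p₁)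
      (q₂ : D₂ ⟶ B) (_ : M.F q₂) (m₂ : E₂ ⟶ D₂) (_ : IsPullback m₂ p₂ q₂ i),
      ∃ (D₁ : 𝓔) (q₁ : D₁ ⟶ B) (v : D₁ ⟶ D₂) (m₁ : E₁ ⟶ D₁),
        M.F q₁ ∧ M.W v ∧ v ≫ q₂ = q₁ ∧ IsPullback m₁ p₁ q₁ i ∧ m₁ ≫ v = w ≫ m₂) :
    ∀ {D A B : 𝓔} (q : D ⟶ A), M.F q → ∀ (j : A ⟶ B), M.C j → M.W j →
      ∃ (E : 𝓔) (p : E ⟶ B) (m : D ⟶ E), M.F p ∧ IsPullback m q p j := by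
  intro D A B q hq j hjC hjW
  obtain ⟨D₂, l, q₂, ⟨-, hlW⟩, hq₂, fac⟩ := M.wfs₂.factorization (q ≫ j)
  have sq := IsPullback.of_hasPullback q₂ j
  have hw : M.W (sq.lift l q fac) := by
    refine M.two_of_three_left _ (pullback.fst q₂ j) (rightProper _ _ _ _ sq hq₂ hjW) ?_
    rwa [sq.lift_fst]
  obtain ⟨E, p, -, m, hp, -, -, hm, -⟩ := EEP j hjC q hq (pullback.snd q₂ j)
    (M.wfs₂.right_of_isPullback sq hq₂) (sq.lift l q fac) hw (sq.lift_snd _ _ _) q₂ hq₂ _ sq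
  exact ⟨E, p, m, hp, hm⟩
end
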